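/- arXiv:2307.06227 — 2 statements merged into one kernel-verified Lean document; each statement's English description precedes it below -/
import Mathlib

section
/- For every p ∈ U, the operator norm of the real Fréchet derivative of f(p) = Re(g(p)³) equals (3/2)·|g(p)|·‖(Dh)_p‖, where (Dh)_p is the complex derivative of h at p and all operator norms are taken with respect to the Euclidean (Hermitian) norm on ℂ². In particular |df| tends to 0 at any point of the closure of U where h extends by the value 0, i.e. the ℤ₂ harmonic 1-form ω = df vanishes to order at least 1/2 along the branching set h⁻¹(0). -/
open Filter

local notation "ℂ²" => EuclideanSpace ℂ (Fin 2)

open Metric Topology in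
/-- The derivative of an entire function on a complex normed space is locally bounded. -/
theorem Complex.exists_eventually_norm_fderiv_le
    {E F : Type*} [NormedAddCommGroup E] [NormedSpace ℂ E] [NormedAddCommGroup F] [NormedSpace ℂ F]
    {h : E → F} (hh : Differentiable ℂ h) (x : E) :
    ∃ C, ∀ᶠ p in 𝓝 x, ‖fderiv ℂ h p‖ ≤ C := by
  obtain ⟨r, hr, hball⟩ := Metric.continuousAt_iff.mp (hh x).continuousAt 1 one_pos
  refine ⟨2 / (r / 2), ?_⟩
  filter_upwards [ball_mem_nhds x (half_pos hr)] with p hp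
  rw [mem_ball] at hp
  refine norm_fderiv_le_div_of_mapsTo_ball hh.differentiableOn (fun q hq => ?_)
    (half_pos hr)
  rw [mem_ball] at hq
  have hqx : dist (h q) (h x) < 1 := hball (by linarith [dist_triangle q p x])
  have hpx : dist (h p) (h x) < 1 := hball (by linarith)
  rw [mem_closedBall]
  linarith [dist_triangle_right (h q) (h p) (h x)]

/-- The real part of a holomorphic function has a real derivative of the same norm as the complex
derivative of the function. -/
theorem HasFDerivAt.norm_fderiv_re
    {E : Type*} [NormedAddCommGroup E] [NormedSpace ℂ E] [NormedSpace ℝ E] [IsScalarTower ℝ ℂ E]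
    {f : E → ℂ} {L : E →L[ℂ] ℂ} {p : E} (hf : HasFDerivAt f L p) :
    ‖fderiv ℝ (fun q => (f q).re) p‖ = ‖L‖ := by
  have hre : HasFDerivAt (fun q => (f q).re) (Complex.reCLM.comp (L.restrictScalars ℝ)) p :=
    Complex.reCLM.hasFDerivAt.comp p (hf.restrictScalars ℝ)
  rw [hre.fderiv]
  exact (StrongDual.extendRCLikeₗᵢ (𝕜 := ℂ) (F := E)).symm.norm_map L

/-- If `g ^ 2 = h` near `p`, then `d (Re g ^ 3)` has norm `(3 / 2) * ‖g p‖ * ‖dh‖` at `p`. -/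
theorem norm_fderiv_re_pow_three_of_sq_eventuallyEq
    {E : Type*} [NormedAddCommGroup E] [NormedSpace ℂ E] [NormedSpace ℝ E] [IsScalarTower ℝ ℂ E]
    {g h : E → ℂ} {p : E} (hg : DifferentiableAt ℂ g p)
    (hgh : (fun q => g q ^ 2) =ᶠ[nhds p] h) :
    ‖fderiv ℝ (fun q => (g q ^ 3).re) p‖ = (3 / 2) * ‖g p‖ * ‖fderiv ℂ h p‖ := by
  rw [(hg.hasFDerivAt.pow 3).norm_fderiv_re, ← hgh.fderiv_eq, (hg.hasFDerivAt.pow 2).fderiv]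
  simp [norm_smul]
  ring

/-- Let `h : ℂ² → ℂ` be holomorphic, `U` open, and `g` a holomorphic branch of `h^{1/2}`
on `U` (i.e. `g² = h` on `U`).  For `f = Re (g³)` (that is, `Re h^{3/2}`), the operator
norm of the real Fréchet derivative of `f` at each `p ∈ U` equals
`(3/2)·|g(p)|·‖(Dh)ₚ‖`, where `(Dh)ₚ` is the complex derivative of `h` at `p` and the
operator norms are with respect to the Euclidean (Hermitian) norm on ℂ².
In particular `|df|` tends to `0` at any point of the closure of `U` where `h` vanishes,
i.e. the ℤ₂ harmonic 1-form `ω = df` vanishes to order at least `1/2` along the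
branching set `h⁻¹(0)`. -/
theorem norm_fderiv_re_h_pow_three_halves
    (h : ℂ² → ℂ) (hh : Differentiable ℂ h)
    (U : Set ℂ²) (hU : IsOpen U)
    (g : ℂ² → ℂ) (hg : DifferentiableOn ℂ g U)
    (hgh : ∀ p ∈ U, g p ^ 2 = h p) :
    (∀ p ∈ U,
      ‖fderiv ℝ (fun q => (g q ^ 3).re) p‖ = (3 / 2) * ‖g p‖ * ‖fderiv ℂ h p‖) ∧
    (∀ x : ℂ², x ∈ closure U → h x = 0 →
      Tendsto (fun p => ‖fderiv ℝ (fun q => (g q ^ 3).re) p‖) (nhdsWithin x U) (nhds 0)) := by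
  have key : ∀ p ∈ U,
      ‖fderiv ℝ (fun q => (g q ^ 3).re) p‖ = (3 / 2) * ‖g p‖ * ‖fderiv ℂ h p‖ := fun p hp =>
    norm_fderiv_re_pow_three_of_sq_eventuallyEq (hg.differentiableAt (hU.mem_nhds hp))
      (by filter_upwards [hU.mem_nhds hp] using hgh)
  refine ⟨key, fun x _ hx => ?_⟩
  obtain ⟨C, hC⟩ := Complex.exists_eventually_norm_fderiv_le hh x
  have hlim : Tendsto (fun p => (3 / 2) * √‖h p‖ * C) (nhdsWithin x U) (nhds 0) := by
    have hcont : Continuous fun p => (3 / 2) * √‖h p‖ * C := by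
      have := hh.continuous
      fun_prop
    simpa [hx] using (hcont.tendsto x).mono_left nhdsWithin_le_nhds
  refine squeeze_zero' (Eventually.of_forall fun p => norm_nonneg _) ?_ hlim
  filter_upwards [self_mem_nhdsWithin, nhdsWithin_le_nhds hC] with p hp hCp
  have hgp : ‖g p‖ = √‖h p‖ := by
    rw [← hgh p hp, norm_pow, Real.sqrt_sq (norm_nonneg _)]
  rw [key p hp, hgp]
  gcongr
end

section
/- Let n ≥ 3, R > 0, and δ < n/2. Suppose u : ℝⁿ → ℝ is C² and harmonic on the exterior domain {x ∈ ℝⁿ : ‖x‖ > R}, and that ∫_{‖x‖ > R} u(x)²·(1 + ‖x‖²)^{−δ} dx < ∞ (i.e. u ∈ M^δ L² where M = (1 + ‖x‖²)^{1/2}). Then there exists a constant C such that |u(x)| ≤ C·‖x‖^{2−n} for all x with ‖x‖ ≥ 2R. -/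
open MeasureTheory

/-- The Laplacian of a real-valued function on Euclidean ℝⁿ: the sum of second
directional derivatives along the standard orthonormal coordinate directions. -/
noncomputable def laplacianE {n : ℕ} (f : EuclideanSpace ℝ (Fin n) → ℝ)
    (x : EuclideanSpace ℝ (Fin n)) : ℝ :=
  ∑ i : Fin n,
    fderiv ℝ (fun y => fderiv ℝ f y (EuclideanSpace.single i (1 : ℝ))) x
      (EuclideanSpace.single i (1 : ℝ))

/-- A real-valued function is harmonic on `U ⊆ ℝⁿ` if it is C² there and its Laplacian
vanishes identically on `U`. -/
def IsHarmonicOnE {n : ℕ} (f : EuclideanSpace ℝ (Fin n) → ℝ)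
    (U : Set (EuclideanSpace ℝ (Fin n))) : Prop :=
  ContDiffOn ℝ 2 f U ∧ ∀ x ∈ U, laplacianE f x = 0

open InnerProductSpace Metric Set Filter
open scoped Topology Laplacian

section Laplacian

variable {E : Type*} [NormedAddCommGroup E] [InnerProductSpace ℝ E]

theorem ContDiffAt.hasFDerivAt_fderiv {f : E → ℝ} {x : E} (hf : ContDiffAt ℝ 2 f x) :
    HasFDerivAt (fderiv ℝ f) (fderiv ℝ (fderiv ℝ f) x) x :=
  ((hf.fderiv_right (m := 1) (by norm_num)).differentiableAt one_ne_zero).hasFDerivAt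

variable [FiniteDimensional ℝ E]

theorem laplacian_eq_sum_fderiv_fderiv {ι : Type*} [Fintype ι] (b : OrthonormalBasis ι ℝ E)
    (f : E → ℝ) (x : E) : Δ f x = ∑ i, fderiv ℝ (fderiv ℝ f) x (b i) (b i) := by
  simp [laplacian_eq_iteratedFDeriv_orthonormalBasis f b, iteratedFDeriv_two_apply]

/-- The Laplacian of a radial function, written as a function of the squared norm. -/
theorem laplacian_comp_norm_sq {φ φ' : ℝ → ℝ} {φ'' : ℝ} {x : E}
    (h : ∀ᶠ t in 𝓝 (‖x‖ ^ 2), HasDerivAt φ (φ' t) t) (h' : HasDerivAt φ' φ'' (‖x‖ ^ 2)) :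
    Δ (fun y : E => φ (‖y‖ ^ 2)) x
      = 4 * ‖x‖ ^ 2 * φ'' + 2 * Module.finrank ℝ E * φ' (‖x‖ ^ 2) := by
  have hsq (y : E) : HasFDerivAt (fun y : E => ‖y‖ ^ 2) (2 • innerSL ℝ y) y :=
    (hasStrictFDerivAt_norm_sq y).hasFDerivAt
  have hfd : fderiv ℝ (fun y : E => φ (‖y‖ ^ 2))
      =ᶠ[𝓝 x] fun y => φ' (‖y‖ ^ 2) • (2 : ℝ) • innerSL ℝ y := by
    filter_upwards [(hsq x).continuousAt.eventually h] with y hy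
    refine (hy.comp_hasFDerivAt y (hsq y)).fderiv.trans ?_
    simp [two_smul]
  have h2 : HasFDerivAt (fun y => φ' (‖y‖ ^ 2) • (2 : ℝ) • innerSL ℝ y) _ x :=
    (h'.comp_hasFDerivAt x (hsq x)).smul
      (((innerSL ℝ : E →L[ℝ] E →L[ℝ] ℝ).hasFDerivAt (x := x)).const_smul (2 : ℝ))
  set b := stdOrthonormalBasis ℝ E
  rw [laplacian_eq_sum_fderiv_fderiv b, hfd.fderiv_eq, h2.fderiv]
  have key : ∑ i, inner ℝ x (b i) * inner ℝ x (b i) = ‖x‖ ^ 2 := by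
    rw [← b.sum_sq_inner_left x]
    simp [sq]
  have hb (i) : inner ℝ (b i) (b i) = (1 : ℝ) := by
    simp
  have hb' (i) : innerSL ℝ (b i) (b i) = (1 : ℝ) := by rw [innerSL_apply_apply, hb]
  simp only [add_apply, smul_apply, ContinuousLinearMap.smulRight_apply, hb', innerSL_apply_apply,
    Finset.sum_add_distrib, Function.comp_apply, smul_eq_mul, Finset.sum_const, Finset.card_univ,
    Fintype.card_fin, nsmul_eq_mul, mul_one]
  rw [← key, Finset.mul_sum, Finset.sum_mul, add_comm]
  congr 1
  · exact Finset.sum_congr rfl fun i _ => by ring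
  · ring

theorem laplacian_norm_sq (x : E) : Δ (fun y : E => ‖y‖ ^ 2) x = 2 * Module.finrank ℝ E := by
  have := laplacian_comp_norm_sq (E := E) (φ := id) (φ' := fun _ => 1) (φ'' := 0) (x := x)
    (Eventually.of_forall fun t => hasDerivAt_id t) (hasDerivAt_const _ _)
  simpa using this

/-- The function `‖x‖ ^ (2 - n)` is harmonic away from the origin of an `n`-dimensional space. -/
theorem laplacian_norm_rpow_two_sub_finrank {x : E} (hx : x ≠ 0) :
    Δ (fun y : E => ‖y‖ ^ (2 - Module.finrank ℝ E : ℝ)) x = 0 := by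
  set p : ℝ := (2 - Module.finrank ℝ E) / 2
  have hpos : 0 < ‖x‖ ^ 2 := by positivity
  have hfun : (fun y : E => ‖y‖ ^ (2 - Module.finrank ℝ E : ℝ)) = fun y => (‖y‖ ^ 2) ^ p := by
    ext y
    rw [← Real.rpow_natCast_mul (norm_nonneg y)]
    congr 1
    simp only [p]
    push_cast
    ring
  have h1 : ∀ᶠ t in 𝓝 (‖x‖ ^ 2), HasDerivAt (fun t : ℝ => t ^ p) (p * t ^ (p - 1)) t := by
    filter_upwards [lt_mem_nhds hpos] with t ht
    exact Real.hasDerivAt_rpow_const (Or.inl ht.ne')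
  have h2 : HasDerivAt (fun t : ℝ => p * t ^ (p - 1))
      (p * ((p - 1) * (‖x‖ ^ 2) ^ (p - 1 - 1))) (‖x‖ ^ 2) :=
    (Real.hasDerivAt_rpow_const (Or.inl hpos.ne')).const_mul p
  rw [hfun, laplacian_comp_norm_sq h1 h2, Real.rpow_sub_one hpos.ne' (p - 1)]
  have : 4 * (p - 1) + 2 * Module.finrank ℝ E = 0 * p := by simp only [p]; ring
  field_simp
  linear_combination p * this

theorem IsLocalMax.laplacian_nonpos {f : E → ℝ} {x : E} (hmax : IsLocalMax f x)
    (hf : ContDiffAt ℝ 2 f x) : Δ f x ≤ 0 := by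
  rw [laplacian_eq_sum_fderiv_fderiv (stdOrthonormalBasis ℝ E)]
  refine Finset.sum_nonpos fun i _ => ?_
  set e := stdOrthonormalBasis ℝ E i
  by_contra! hpos
  set γ : ℝ → E := fun t => x + t • e
  have hγ0 : γ 0 = x := by simp [γ]
  have hγ (t : ℝ) : HasDerivAt γ e t := by
    simpa only [one_smul, id] using ((hasDerivAt_id t).smul_const e).const_add x
  have htend : Tendsto γ (𝓝 0) (𝓝 x) := hγ0 ▸ (hγ 0).continuousAt
  have hd : ∀ᶠ t in 𝓝 0, HasDerivAt (f ∘ γ) (fderiv ℝ f (γ t) e) t := by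
    filter_upwards [htend.eventually (hf.eventually (by simp))] with t ht
    exact (ht.differentiableAt two_ne_zero).hasFDerivAt.comp_hasDerivAt t (hγ t)
  have hmax' : IsLocalMax (f ∘ γ) 0 := by
    filter_upwards [htend.eventually hmax] with t ht
    simpa [hγ0] using ht
  have hdd : HasDerivAt (fun t => fderiv ℝ f (γ t) e) (fderiv ℝ (fderiv ℝ f) x e e) 0 := by
    have h := hf.hasFDerivAt_fderiv
    rw [← hγ0] at h
    have h3 := (h.comp_hasDerivAt (0 : ℝ) (hγ 0)).clm_apply (hasDerivAt_const (0 : ℝ) e)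
    simpa [hγ0] using h3
  have hderiv : deriv (f ∘ γ) =ᶠ[𝓝 0] fun t => fderiv ℝ f (γ t) e := hd.mono fun t ht => ht.deriv
  have h2 : deriv (deriv (f ∘ γ)) 0 = fderiv ℝ (fderiv ℝ f) x e e := by
    rw [hderiv.deriv_eq, hdd.deriv]
  have hmin : IsLocalMin (f ∘ γ) 0 :=
    isLocalMin_of_deriv_deriv_pos (h2 ▸ hpos) hmax'.deriv_eq_zero
      hd.self_of_nhds.continuousAt
  have hconst : f ∘ γ =ᶠ[𝓝 0] fun _ => f (γ 0) := by
    filter_upwards [hmax', hmin] with t h1 h2 using le_antisymm h1 h2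
  rw [hconst.deriv.deriv_eq] at h2
  simp at h2
  linarith

end Laplacian

theorem ContDiffAt.laplacianE_eq_laplacian {n : ℕ} {f : EuclideanSpace ℝ (Fin n) → ℝ}
    {x : EuclideanSpace ℝ (Fin n)} (hf : ContDiffAt ℝ 2 f x) : laplacianE f x = Δ f x := by
  rw [laplacian_eq_sum_fderiv_fderiv (EuclideanSpace.basisFun (Fin n) ℝ), laplacianE]
  refine Finset.sum_congr rfl fun i _ => ?_
  simp only [EuclideanSpace.basisFun_apply]
  rw [(hf.hasFDerivAt_fderiv.clm_apply (hasFDerivAt_const _ x)).fderiv]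
  simp

theorem hasDerivAt_max_zero_pow_three (t : ℝ) :
    HasDerivAt (fun t : ℝ => max t 0 ^ 3) (3 * max t 0 ^ 2) t := by
  rcases lt_trichotomy t 0 with ht | rfl | ht
  · rw [max_eq_right ht.le]
    refine ((hasDerivAt_const t (0 : ℝ)).congr_of_eventuallyEq ?_).congr_deriv (by simp)
    filter_upwards [gt_mem_nhds ht] with s hs
    simp [max_eq_right hs.le]
  · have h : HasDerivAt (fun t : ℝ => t ^ 3) 0 0 := by simpa using hasDerivAt_pow 3 (0 : ℝ)
    rw [hasDerivAt_iff_isLittleO] at h ⊢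
    refine (Asymptotics.IsBigO.of_bound 1 (Eventually.of_forall fun s => ?_)).trans_isLittleO h
    rcases le_total s 0 with hs | hs
    · simp only [max_eq_right hs]
      simp
    · simp [max_eq_left hs]
  · rw [max_eq_left ht.le]
    refine ((hasDerivAt_pow 3 t).congr_of_eventuallyEq ?_).congr_deriv (by norm_num)
    filter_upwards [lt_mem_nhds ht] with s hs
    simp [max_eq_left hs.le]

section MeanValue

variable {E : Type*} [NormedAddCommGroup E]

/-- A radial weight supported in the closed unit ball. -/
noncomputable def radialBump (y : E) : ℝ := max (1 - ‖y‖ ^ 2) 0 ^ 2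

/-- A potential of the vector field `y ↦ radialBump y • y`, supported in the closed unit ball. -/
noncomputable def radialBumpPotential (y : E) : ℝ := -(1 / 6) * max (1 - ‖y‖ ^ 2) 0 ^ 3

theorem radialBump_nonneg (y : E) : 0 ≤ radialBump y := sq_nonneg _

theorem radialBump_le_one (y : E) : radialBump y ≤ 1 := by
  refine pow_le_one₀ (le_max_right _ _) (max_le ?_ zero_le_one)
  nlinarith [sq_nonneg ‖y‖]

theorem continuous_radialBump : Continuous (radialBump : E → ℝ) := by
  unfold radialBump
  fun_prop

theorem max_one_sub_norm_sq_eq_zero {y : E} (hy : 1 ≤ ‖y‖) : max (1 - ‖y‖ ^ 2) 0 = 0 :=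
  max_eq_right (by nlinarith)

theorem radialBump_eq_zero {y : E} (hy : 1 ≤ ‖y‖) : radialBump y = 0 := by
  simp [radialBump, max_one_sub_norm_sq_eq_zero hy]

theorem radialBumpPotential_eq_zero {y : E} (hy : 1 ≤ ‖y‖) : radialBumpPotential y = 0 := by
  simp [radialBumpPotential, max_one_sub_norm_sq_eq_zero hy]

variable [InnerProductSpace ℝ E]

theorem hasFDerivAt_radialBumpPotential (y : E) :
    HasFDerivAt (radialBumpPotential : E → ℝ) (radialBump y • innerSL ℝ y) y := by
  have h := ((hasDerivAt_max_zero_pow_three (1 - ‖y‖ ^ 2)).comp_hasFDerivAt y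
    ((hasStrictFDerivAt_norm_sq y).hasFDerivAt.const_sub 1)).const_mul (-(1 / 6))
  refine h.congr_fderiv ?_
  ext z
  simp [radialBump]
  ring

variable [FiniteDimensional ℝ E]

theorem hasCompactSupport_of_eq_zero_of_one_le_norm {f : E → ℝ}
    (hf : ∀ y, 1 ≤ ‖y‖ → f y = 0) : HasCompactSupport f := by
  refine HasCompactSupport.intro (isCompact_closedBall 0 1) fun y hy => hf y ?_
  rw [mem_closedBall_zero_iff, not_le] at hy
  exact hy.le

variable [MeasurableSpace E] [BorelSpace E]

theorem integrable_of_eq_zero_of_one_le_norm {f : E → ℝ} (hc : Continuous f)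
    (hf : ∀ y, 1 ≤ ‖y‖ → f y = 0) : Integrable f :=
  hc.integrable_of_hasCompactSupport (hasCompactSupport_of_eq_zero_of_one_le_norm hf)

theorem integrable_radialBump_mul {f : E → ℝ} (hf : Continuous f) :
    Integrable fun y => radialBump y * f y :=
  integrable_of_eq_zero_of_one_le_norm (continuous_radialBump.mul hf)
    fun y hy => by simp [radialBump_eq_zero hy]

theorem integrable_radialBump : Integrable (radialBump : E → ℝ) :=
  integrable_of_eq_zero_of_one_le_norm continuous_radialBump fun _ => radialBump_eq_zero

theorem integral_radialBump_pos : 0 < ∫ y : E, radialBump y := by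
  refine integral_pos_of_integrable_nonneg_nonzero (x := 0) continuous_radialBump
    integrable_radialBump radialBump_nonneg ?_
  simp [radialBump]

theorem hasDerivAt_integral_radialBump_mul {v : E → ℝ} (hv : ContDiff ℝ 1 v) (x : E) (s : ℝ) :
    HasDerivAt (fun s : ℝ => ∫ y, radialBump y * v (x + s • y))
      (∫ y, radialBump y * fderiv ℝ v (x + s • y) y) s := by
  have hfd : Continuous (fderiv ℝ v) := hv.continuous_fderiv one_ne_zero
  have hvc : Continuous v := hv.continuous
  have hcont : Continuous fun p : ℝ × E => fderiv ℝ v (x + p.1 • p.2) p.2 := by fun_prop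
  obtain ⟨B, hB⟩ := ((isCompact_closedBall s 1).prod
    (isCompact_closedBall (0 : E) 1)).exists_bound_of_continuousOn hcont.continuousOn
  refine (hasDerivAt_integral_of_dominated_loc_of_deriv_le
    (F := fun (s : ℝ) y => radialBump y * v (x + s • y))
    (F' := fun (s : ℝ) y => radialBump y * fderiv ℝ v (x + s • y) y)
    (bound := fun y => radialBump y * B)
    (closedBall_mem_nhds s one_pos) ?_ ?_ ?_ ?_ ?_ ?_).2
  · exact Eventually.of_forall fun t =>
      (integrable_radialBump_mul (by fun_prop)).aestronglyMeasurable
  · exact integrable_radialBump_mul (by fun_prop)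
  · exact (integrable_radialBump_mul (by fun_prop)).aestronglyMeasurable
  · refine Eventually.of_forall fun y t ht => ?_
    rcases le_total 1 ‖y‖ with hy | hy
    · simp [radialBump_eq_zero hy]
    · rw [norm_mul, Real.norm_of_nonneg (radialBump_nonneg y)]
      exact mul_le_mul_of_nonneg_left (hB (t, y) ⟨ht, by simpa using hy⟩) (radialBump_nonneg y)
  · exact integrable_radialBump.mul_const B
  · refine Eventually.of_forall fun y t _ => HasDerivAt.const_mul _ ?_
    have hγ : HasDerivAt (fun t : ℝ => x + t • y) y t := by
      simpa only [one_smul, id] using ((hasDerivAt_id t).smul_const y).const_add x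
    exact ((hv.differentiable one_ne_zero).differentiableAt.hasFDerivAt).comp_hasDerivAt t hγ

theorem integral_radialBump_mul_fderiv {v : E → ℝ} (hv : ContDiff ℝ 2 v) {x : E} {r s : ℝ}
    (hs : 0 ≤ s) (hsr : s ≤ r) (hΔ : ∀ z ∈ ball x r, Δ v z = 0) :
    ∫ y, radialBump y * fderiv ℝ v (x + s • y) y = 0 := by
  set b := stdOrthonormalBasis ℝ E
  have hfd : Continuous (fderiv ℝ v) := hv.continuous_fderiv two_ne_zero
  have hfd2 : Continuous (fderiv ℝ (fderiv ℝ v)) :=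
    (hv.fderiv_right (m := 1) (by norm_num)).continuous_fderiv one_ne_zero
  have hψc : Continuous (radialBumpPotential : E → ℝ) :=
    continuous_iff_continuousAt.2 fun y => (hasFDerivAt_radialBumpPotential y).continuousAt
  have hψ (y e : E) : fderiv ℝ radialBumpPotential y e = radialBump y * inner ℝ y e := by
    simp [(hasFDerivAt_radialBumpPotential y).fderiv]
  have hg (e y : E) : HasFDerivAt (fun y => fderiv ℝ v (x + s • y) e)
      ((ContinuousLinearMap.apply ℝ ℝ e).comp
        ((fderiv ℝ (fderiv ℝ v) (x + s • y)).comp (s • ContinuousLinearMap.id ℝ E))) y :=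
    (ContinuousLinearMap.apply ℝ ℝ e).hasFDerivAt.comp y
      (hv.contDiffAt.hasFDerivAt_fderiv.comp y (((hasFDerivAt_id y).const_smul s).const_add x))
  have hg' (e y : E) : fderiv ℝ (fun y => fderiv ℝ v (x + s • y) e) y e
      = s * fderiv ℝ (fderiv ℝ v) (x + s • y) e e := by
    simp [(hg e y).fderiv]
  have hint (e : E) : Integrable fun y =>
      radialBumpPotential y * (s * fderiv ℝ (fderiv ℝ v) (x + s • y) e e) :=
    integrable_of_eq_zero_of_one_le_norm (by fun_prop)
      fun y hy => by simp [radialBumpPotential_eq_zero hy]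
  have hint' (e : E) : Integrable fun y =>
      radialBump y * inner ℝ y e * fderiv ℝ v (x + s • y) e := by
    simp only [mul_assoc]
    exact integrable_radialBump_mul (by fun_prop)
  have hparts (e : E) :
      ∫ y, radialBump y * inner ℝ y e * fderiv ℝ v (x + s • y) e
        = -∫ y, radialBumpPotential y * (s * fderiv ℝ (fderiv ℝ v) (x + s • y) e e) := by
    have h := integral_mul_fderiv_eq_neg_fderiv_mul_of_integrable (μ := (volume : Measure E))
      (f := radialBumpPotential) (g := fun y => fderiv ℝ v (x + s • y) e) (v := e)
      (by simpa only [hψ] using hint' e) (by simpa only [hg'] using hint e)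
      (integrable_of_eq_zero_of_one_le_norm (by fun_prop)
        fun y hy => by simp [radialBumpPotential_eq_zero hy])
      (fun y _ => (hasFDerivAt_radialBumpPotential y).differentiableAt)
      (fun y _ => (hg e y).differentiableAt)
    simp only [hψ, hg'] at h
    rw [h, neg_neg]
  calc ∫ y, radialBump y * fderiv ℝ v (x + s • y) y
      = ∫ y, ∑ i, radialBump y * inner ℝ y (b i) * fderiv ℝ v (x + s • y) (b i) := by
        congr 1 with y
        nth_rw 3 [← b.sum_repr' y]
        simp only [map_sum, map_smul, smul_eq_mul, Finset.mul_sum, mul_assoc, real_inner_comm]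
    _ = -∫ y, ∑ i, radialBumpPotential y *
          (s * fderiv ℝ (fderiv ℝ v) (x + s • y) (b i) (b i)) := by
        rw [integral_finsetSum _ fun i _ => hint' (b i),
          integral_finsetSum _ fun i _ => hint (b i), ← Finset.sum_neg_distrib]
        exact Finset.sum_congr rfl fun i _ => hparts (b i)
    _ = 0 := by
        rw [neg_eq_zero]
        refine integral_eq_zero_of_ae (Eventually.of_forall fun y => ?_)
        simp only [← Finset.mul_sum, ← laplacian_eq_sum_fderiv_fderiv b]
        rcases le_or_gt 1 ‖y‖ with hy | hy
        · simp [radialBumpPotential_eq_zero hy]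
        rcases hs.eq_or_lt with rfl | hs
        · simp
        · rw [hΔ _ (by
            rw [mem_ball_iff_norm, add_sub_cancel_left, norm_smul, Real.norm_of_nonneg hs.le]
            nlinarith)]
          simp

/-- A weighted form of the mean value property of harmonic functions. -/
theorem integral_radialBump_mul_eq {v : E → ℝ} (hv : ContDiff ℝ 2 v) {x : E} {r : ℝ}
    (hr : 0 ≤ r) (hΔ : ∀ z ∈ ball x r, Δ v z = 0) :
    ∫ y, radialBump y * v (x + r • y) = (∫ y : E, radialBump y) * v x := by
  have hd := hasDerivAt_integral_radialBump_mul (hv.of_le (by norm_num) : ContDiff ℝ 1 v) x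
  have h := constant_of_has_deriv_right_zero (a := 0) (b := r)
    (fun s _ => (hd s).continuousAt.continuousWithinAt)
    (fun s hs => ((hd s).congr_deriv
      (integral_radialBump_mul_fderiv hv hs.1 hs.2.le hΔ)).hasDerivWithinAt) r ⟨hr, le_rfl⟩
  simpa [integral_mul_const] using h

theorem sq_mul_integral_radialBump_le {v : E → ℝ} (hv : ContDiff ℝ 2 v) {x : E} {r : ℝ}
    (hr : 0 ≤ r) (hΔ : ∀ z ∈ ball x r, Δ v z = 0) :
    v x ^ 2 * ∫ y : E, radialBump y ≤ ∫ y, radialBump y * v (x + r • y) ^ 2 := by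
  have hvc : Continuous v := hv.continuous
  have h : ∫ y, (2 * v x * (radialBump y * v (x + r • y)) - v x ^ 2 * radialBump y)
      ≤ ∫ y, radialBump y * v (x + r • y) ^ 2 := by
    refine integral_mono (((integrable_radialBump_mul (by fun_prop)).const_mul _).sub
      (integrable_radialBump.const_mul _)) (integrable_radialBump_mul (by fun_prop)) fun y => ?_
    have := mul_nonneg (radialBump_nonneg y) (sq_nonneg (v (x + r • y) - v x))
    dsimp only
    linarith
  rw [integral_sub ((integrable_radialBump_mul (by fun_prop)).const_mul _)
    (integrable_radialBump.const_mul _), integral_const_mul, integral_const_mul,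
    integral_radialBump_mul_eq hv hr hΔ] at h
  linarith

theorem integral_radialBump_mul_comp (f : E → ℝ) (x : E) {r : ℝ} (hr : 0 < r) :
    ∫ y, radialBump y * f (x + r • y)
      = (r ^ Module.finrank ℝ E)⁻¹ * ∫ z, radialBump (r⁻¹ • (z - x)) * f z := by
  have h := Measure.integral_comp_smul (volume : Measure E)
    (fun w => radialBump (r⁻¹ • w) * f (x + w)) r
  have h2 := integral_add_left_eq_self (μ := (volume : Measure E))
    (fun z => radialBump (r⁻¹ • (z - x)) * f z) x
  simp only [add_sub_cancel_left] at h2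
  rw [h2, abs_of_pos (by positivity)] at h
  simpa [smul_smul, inv_mul_cancel₀ hr.ne'] using h

end MeanValue

section Decay

variable {E : Type*} [NormedAddCommGroup E] [InnerProductSpace ℝ E] [FiniteDimensional ℝ E]

/-- A weak maximum principle on a compact annulus. -/
theorem le_of_laplacian_eq_zero_of_annulus {f : E → ℝ} {a b M : ℝ}
    (hf : ∀ x : E, a ≤ ‖x‖ → ContDiffAt ℝ 2 f x) (hΔ : ∀ x : E, a ≤ ‖x‖ → Δ f x = 0)
    (hfa : ∀ x : E, ‖x‖ = a → f x ≤ M) (hfb : ∀ x : E, ‖x‖ = b → f x ≤ M)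
    (hn : 0 < Module.finrank ℝ E) {x : E} (hax : a ≤ ‖x‖) (hxb : ‖x‖ ≤ b) : f x ≤ M := by
  refine le_of_forall_pos_le_add fun ε hε => ?_
  obtain ⟨η, hη, hηε⟩ : ∃ η : ℝ, 0 < η ∧ η * b ^ 2 ≤ ε := by
    refine ⟨ε / (b ^ 2 + 1), by positivity, ?_⟩
    rw [div_mul_eq_mul_div, div_le_iff₀ (by positivity)]
    nlinarith
  set g : E → ℝ := f + η • fun y => ‖y‖ ^ 2 with hg_def
  have hsq (y : E) : ContDiffAt ℝ 2 (fun y : E => ‖y‖ ^ 2) y := (contDiff_norm_sq ℝ).contDiffAt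
  have hg (y : E) (hy : a ≤ ‖y‖) : ContDiffAt ℝ 2 g y := (hf y hy).add ((hsq y).const_smul η)
  have hK : IsCompact {y : E | a ≤ ‖y‖ ∧ ‖y‖ ≤ b} := by
    refine (isCompact_closedBall (0 : E) b).of_isClosed_subset ?_ fun y hy => by simpa using hy.2
    exact (isClosed_le continuous_const continuous_norm).inter
      (isClosed_le continuous_norm continuous_const)
  obtain ⟨y, ⟨hay, hyb⟩, hy⟩ := hK.exists_isMaxOn ⟨x, hax, hxb⟩
    fun z hz => (hg z hz.1).continuousAt.continuousWithinAt
  have hxy : g x ≤ g y := hy ⟨hax, hxb⟩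
  have hfg : f x ≤ g x := by
    simp only [hg_def, Pi.add_apply, Pi.smul_apply, smul_eq_mul]
    nlinarith [sq_nonneg ‖x‖]
  suffices f y ≤ M by
    have : η * ‖y‖ ^ 2 ≤ η * b ^ 2 := by gcongr
    simp only [hg_def, Pi.add_apply, Pi.smul_apply, smul_eq_mul] at hxy hfg
    linarith
  rcases hay.eq_or_lt with hay' | hay'
  · exact hfa y hay'.symm
  rcases hyb.eq_or_lt with hyb' | hyb'
  · exact hfb y hyb'
  exfalso
  have hmax : IsLocalMax g y := by
    refine hy.isLocalMax ?_
    exact Filter.inter_mem (continuous_norm.continuousAt.eventually (le_mem_nhds hay'))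
      (continuous_norm.continuousAt.eventually (ge_mem_nhds hyb'))
  have h := hmax.laplacian_nonpos (hg y hay)
  have hsq' : ContDiffAt ℝ 2 (η • fun y : E => ‖y‖ ^ 2) y := (hsq y).const_smul η
  rw [hg_def, (hf y hay).laplacian_add hsq', hΔ y hay, laplacian_smul η (hsq y),
    laplacian_norm_sq, smul_eq_mul, zero_add] at h
  have : (0 : ℝ) < Module.finrank ℝ E := mod_cast hn
  exact absurd h (not_le.2 (by positivity))

/-- A harmonic function tending to zero at infinity is bounded above by a multiple of
`‖x‖ ^ (2 - n)`. -/
theorem exists_le_mul_norm_rpow_of_tendsto_zero {f : E → ℝ} {a : ℝ} (ha : 0 < a)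
    (hf : ∀ x : E, a ≤ ‖x‖ → ContDiffAt ℝ 2 f x) (hΔ : ∀ x : E, a ≤ ‖x‖ → Δ f x = 0)
    (hlim : ∀ ε > 0, ∃ S : ℝ, ∀ x : E, S ≤ ‖x‖ → f x ≤ ε) (hn : 0 < Module.finrank ℝ E) :
    ∃ C : ℝ, ∀ x : E, a ≤ ‖x‖ → f x ≤ C * ‖x‖ ^ (2 - Module.finrank ℝ E : ℝ) := by
  set p : ℝ := 2 - Module.finrank ℝ E
  have hap : 0 < a ^ p := Real.rpow_pos_of_pos ha p
  obtain ⟨B, hB⟩ := (isCompact_sphere (0 : E) a).exists_bound_of_continuousOn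
    (f := f) fun x hx =>
      (hf x (mem_sphere_zero_iff_norm.1 hx).ge).continuousAt.continuousWithinAt
  set C : ℝ := |B| / a ^ p
  have hC : 0 ≤ C := by positivity
  refine ⟨C, fun x hx => le_of_forall_pos_le_add fun ε hε => ?_⟩
  obtain ⟨S, hS⟩ := hlim ε hε
  have hp (y : E) (hy : a ≤ ‖y‖) : ContDiffAt ℝ 2 (fun y : E => ‖y‖ ^ p) y :=
    (contDiffAt_norm ℝ (norm_pos_iff.1 (ha.trans_le hy))).rpow_const_of_ne
      (ha.trans_le hy).ne'
  have h := le_of_laplacian_eq_zero_of_annulus (f := f - C • fun y => ‖y‖ ^ p) (a := a)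
    (b := max S ‖x‖) (M := ε) (fun y hy => (hf y hy).sub ((hp y hy).const_smul C))
    (fun y hy => by
      have hp' : ContDiffAt ℝ 2 (C • fun y : E => ‖y‖ ^ p) y := (hp y hy).const_smul C
      rw [(hf y hy).laplacian_sub hp', hΔ y hy, laplacian_smul C (hp y hy),
        laplacian_norm_rpow_two_sub_finrank (norm_pos_iff.1 (ha.trans_le hy))]
      simp)
    (fun y hy => by
      have h1 := (le_abs_self _).trans ((hB y (by simpa using hy)).trans (le_abs_self B))
      have h2 : C * a ^ p = |B| := div_mul_cancel₀ _ hap.ne'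
      simp only [Pi.sub_apply, Pi.smul_apply, smul_eq_mul, hy, h2]
      linarith)
    (fun y hy => by
      have h1 := hS y (hy ▸ le_max_left _ _)
      have h2 : 0 ≤ C * ‖y‖ ^ p := by positivity
      simp only [Pi.sub_apply, Pi.smul_apply, smul_eq_mul]
      linarith)
    hn hx (le_max_right _ _)
  simp only [Pi.sub_apply, Pi.smul_apply, smul_eq_mul] at h
  linarith

variable [MeasurableSpace E] [BorelSpace E]

theorem sq_mul_integral_radialBump_le_setIntegral {u : E → ℝ} {x : E} {r r' : ℝ} (hr : 0 < r)
    (hr' : r < r') (hu : ∀ z ∈ closedBall x r', ContDiffAt ℝ 2 u z)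
    (hΔ : ∀ z ∈ closedBall x r', Δ u z = 0) :
    u x ^ 2 * ∫ y : E, radialBump y
      ≤ (r ^ Module.finrank ℝ E)⁻¹ * ∫ z in closedBall x r, u z ^ 2 := by
  let χ : ContDiffBump x := ⟨r, r', hr, hr'⟩
  set v : E → ℝ := fun z => χ z * u z
  have hv : ContDiff ℝ 2 v := by
    refine contDiff_iff_contDiffAt.2 fun z => ?_
    by_cases hz : z ∈ closedBall x r'
    · exact χ.contDiff.contDiffAt.mul (hu z hz)
    · refine (contDiffAt_const (c := (0 : ℝ))).congr_of_eventuallyEq ?_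
      have hz' : z ∉ tsupport χ := by rwa [χ.tsupport_eq]
      filter_upwards [notMem_tsupport_iff_eventuallyEq.1 hz'] with y hy
      simp [v, hy]
  have hvu : ∀ z ∈ closedBall x r, v z = u z := fun z hz => by
    simp [v, χ.one_of_mem_closedBall hz]
  have hvΔ : ∀ z ∈ ball x r, Δ v z = 0 := fun z hz => by
    have : v =ᶠ[𝓝 z] u := by
      filter_upwards [isOpen_ball.mem_nhds hz] with y hy using hvu y (ball_subset_closedBall hy)
    rw [(laplacian_congr_nhds this).self_of_nhds]
    exact hΔ z (closedBall_subset_closedBall hr'.le (ball_subset_closedBall hz))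
  have h := sq_mul_integral_radialBump_le hv hr.le hvΔ
  rw [hvu x (mem_closedBall_self hr.le),
    integral_radialBump_mul_comp (fun z => v z ^ 2) x hr] at h
  refine h.trans (mul_le_mul_of_nonneg_left ?_ (by positivity))
  rw [← integral_indicator measurableSet_closedBall]
  refine integral_mono_of_nonneg (Eventually.of_forall fun z =>
    mul_nonneg (radialBump_nonneg _) (sq_nonneg _)) ?_ (Eventually.of_forall fun z => ?_)
  · rw [integrable_indicator_iff measurableSet_closedBall]
    refine ContinuousOn.integrableOn_compact (isCompact_closedBall x r) fun z hz => ?_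
    exact ((hu z (closedBall_subset_closedBall hr'.le hz)).continuousAt.pow 2).continuousWithinAt
  · by_cases hz : z ∈ closedBall x r
    · simp only [indicator_of_mem hz, hvu z hz]
      exact mul_le_of_le_one_left (sq_nonneg _) (radialBump_le_one _)
    · rw [indicator_of_notMem hz]
      rw [mem_closedBall_iff_norm, not_le] at hz
      refine (mul_eq_zero_of_left (radialBump_eq_zero ?_) _).le
      rw [norm_smul, Real.norm_of_nonneg (by positivity), ← div_eq_inv_mul, one_le_div hr]
      exact hz.le

theorem one_le_mul_rpow_neg {δ s t : ℝ} (hs : 1 ≤ s) (hst : s ≤ t) :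
    1 ≤ t ^ max δ 0 * s ^ (-δ) := by
  have hs0 : 0 < s := by linarith
  calc (1 : ℝ) = s ^ max δ 0 * s ^ (-max δ 0) := by
        rw [← Real.rpow_add hs0, add_neg_cancel, Real.rpow_zero]
    _ ≤ t ^ max δ 0 * s ^ (-δ) := by
        have h0 : 0 ≤ max δ 0 := le_max_right _ _
        have ht0 : 0 ≤ t := by linarith
        gcongr
        exact le_max_left _ _

/-- Pointwise decay of a harmonic function with finite weighted `L²` norm. -/
theorem exists_sq_le_mul_norm_rpow {u : E → ℝ} {R δ : ℝ} (hR : 0 < R)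
    (hu : ∀ z : E, R < ‖z‖ → ContDiffAt ℝ 2 u z) (hΔ : ∀ z : E, R < ‖z‖ → Δ u z = 0)
    (hint : IntegrableOn (fun x : E => u x ^ 2 * (1 + ‖x‖ ^ 2) ^ (-δ)) {x : E | R < ‖x‖}) :
    ∃ C : ℝ, ∀ x : E, 8 * R ≤ ‖x‖ →
      u x ^ 2 ≤ C * ‖x‖ ^ (2 * max δ 0 - Module.finrank ℝ E) := by
  set q : ℝ := max δ 0
  set d := Module.finrank ℝ E
  set I : ℝ := ∫ z in {x : E | R < ‖x‖}, u z ^ 2 * (1 + ‖z‖ ^ 2) ^ (-δ)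
  set m : ℝ := ∫ y : E, radialBump y
  have hm : 0 < m := integral_radialBump_pos
  set L : ℝ := 1 / R ^ 2 + 4
  have hL : 0 < L := by positivity
  refine ⟨2 ^ d * L ^ q * I / m, fun x hx => ?_⟩
  have hx0 : 0 < ‖x‖ := by linarith
  have hball (z : E) {r : ℝ} (hz : z ∈ closedBall x r) : ‖x‖ - r ≤ ‖z‖ ∧ ‖z‖ ≤ ‖x‖ + r := by
    rw [mem_closedBall_iff_norm] at hz
    have h1 := norm_sub_norm_le z x
    have h2 := norm_sub_norm_le x z
    rw [norm_sub_rev] at h2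
    constructor <;> linarith
  have hext (z : E) (hz : z ∈ closedBall x (‖x‖ * (3 / 4))) : R < ‖z‖ := by
    have := (hball z hz).1
    linarith
  have hsub : closedBall x (‖x‖ / 2) ⊆ {x : E | R < ‖x‖} := fun z hz =>
    hext z (closedBall_subset_closedBall (by linarith) hz)
  have h := sq_mul_integral_radialBump_le_setIntegral (r := ‖x‖ / 2) (half_pos hx0)
    (by linarith) (fun z hz => hu z (hext z hz)) (fun z hz => hΔ z (hext z hz))
  have hle : ∫ z in closedBall x (‖x‖ / 2), u z ^ 2 ≤ (L * ‖x‖ ^ 2) ^ q * I := by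
    calc ∫ z in closedBall x (‖x‖ / 2), u z ^ 2
        ≤ ∫ z in closedBall x (‖x‖ / 2),
            (L * ‖x‖ ^ 2) ^ q * (u z ^ 2 * (1 + ‖z‖ ^ 2) ^ (-δ)) := by
          refine setIntegral_mono_on ?_ ((hint.mono_set hsub).const_mul _)
            measurableSet_closedBall fun z hz => ?_
          · exact ContinuousOn.integrableOn_compact (isCompact_closedBall x _) fun z hz =>
              ((hu z (hsub hz)).continuousAt.pow 2).continuousWithinAt
          · have hs : 1 + ‖z‖ ^ 2 ≤ L * ‖x‖ ^ 2 := by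
              have h1 : ‖z‖ ≤ 2 * ‖x‖ := by linarith [(hball z hz).2]
              have h2 : ‖z‖ ^ 2 ≤ (2 * ‖x‖) ^ 2 := by gcongr
              have h3 : 1 ≤ 1 / R ^ 2 * ‖x‖ ^ 2 := by
                rw [div_mul_eq_mul_div, one_mul, one_le_div (by positivity)]
                gcongr
                linarith
              simp only [L]
              linarith
            have := mul_le_mul_of_nonneg_left
              (one_le_mul_rpow_neg (δ := δ) (by nlinarith [sq_nonneg ‖z‖]) hs) (sq_nonneg (u z))
            linarith
      _ = (L * ‖x‖ ^ 2) ^ q *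
            ∫ z in closedBall x (‖x‖ / 2), u z ^ 2 * (1 + ‖z‖ ^ 2) ^ (-δ) :=
          integral_const_mul _ _
      _ ≤ (L * ‖x‖ ^ 2) ^ q * I := by
          gcongr
          exact setIntegral_mono_set hint
            (Eventually.of_forall fun z => by dsimp only [Pi.zero_apply]; positivity)
            (Eventually.of_forall hsub)
  have hpow : (L * ‖x‖ ^ 2) ^ q = L ^ q * ‖x‖ ^ (2 * q) := by
    rw [Real.mul_rpow hL.le (by positivity), ← Real.rpow_natCast_mul hx0.le]
    norm_num
  rw [div_mul_eq_mul_div, le_div_iff₀ hm, Real.rpow_sub hx0, Real.rpow_natCast]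
  refine h.trans ((mul_le_mul_of_nonneg_left hle (by positivity)).trans_eq ?_)
  rw [hpow, div_pow]
  simp only [d]
  field_simp

theorem exists_abs_le_mul_norm_rpow_two_sub_finrank {u : E → ℝ} {R δ : ℝ} (hR : 0 < R)
    (hn : 0 < Module.finrank ℝ E) (hδ : δ < Module.finrank ℝ E / 2)
    (hu : ∀ z : E, R < ‖z‖ → ContDiffAt ℝ 2 u z) (hΔ : ∀ z : E, R < ‖z‖ → Δ u z = 0)
    (hint : IntegrableOn (fun x : E => u x ^ 2 * (1 + ‖x‖ ^ 2) ^ (-δ)) {x : E | R < ‖x‖}) :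
    ∃ C : ℝ, ∀ x : E, 2 * R ≤ ‖x‖ → |u x| ≤ C * ‖x‖ ^ (2 - Module.finrank ℝ E : ℝ) := by
  obtain ⟨C, hC⟩ := exists_sq_le_mul_norm_rpow hR hu hΔ hint
  have hexp : 2 * max δ 0 - Module.finrank ℝ E < 0 := by
    have : (0 : ℝ) < Module.finrank ℝ E := mod_cast hn
    rcases max_cases δ 0 with ⟨h, -⟩ | ⟨h, -⟩ <;> rw [h] <;> linarith
  have hlim : ∀ ε > 0, ∃ S : ℝ, ∀ x : E, S ≤ ‖x‖ → |u x| ≤ ε := fun ε hε => by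
    have ht := (tendsto_rpow_neg_atTop (neg_pos.2 hexp)).const_mul C
    rw [mul_zero, neg_neg] at ht
    obtain ⟨S, hS⟩ := eventually_atTop.1 (ht.eventually (gt_mem_nhds (pow_pos hε 2)))
    refine ⟨max S (8 * R), fun x hx => abs_le_of_sq_le_sq ?_ hε.le⟩
    exact (hC x ((le_max_right _ _).trans hx)).trans (hS _ ((le_max_left _ _).trans hx)).le
  have hlt {z : E} (hz : 2 * R ≤ ‖z‖) : R < ‖z‖ := by linarith
  obtain ⟨C₁, hC₁⟩ := exists_le_mul_norm_rpow_of_tendsto_zero (f := u) (a := 2 * R) (by positivity)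
    (fun z hz => hu z (hlt hz)) (fun z hz => hΔ z (hlt hz))
    (fun ε hε => (hlim ε hε).imp fun S hS x hx => (le_abs_self _).trans (hS x hx)) hn
  obtain ⟨C₂, hC₂⟩ := exists_le_mul_norm_rpow_of_tendsto_zero (f := -u) (a := 2 * R)
    (by positivity) (fun z hz => (hu z (hlt hz)).neg)
    (fun z hz => by simp [laplacian_neg, hΔ z (hlt hz)])
    (fun ε hε => (hlim ε hε).imp fun S hS x hx => (neg_le_abs _).trans (hS x hx)) hn
  refine ⟨max C₁ C₂, fun x hx => abs_le'.2 ⟨(hC₁ x hx).trans ?_, (hC₂ x hx).trans ?_⟩⟩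
  · gcongr
    exact le_max_left _ _
  · gcongr
    exact le_max_right _ _

end Decay

/-- Let `n ≥ 3`, `R > 0` and `δ < n/2`.  If `u` is C² and harmonic on the exterior
domain `{‖x‖ > R} ⊆ ℝⁿ` and `∫_{‖x‖>R} u²·(1+‖x‖²)^{−δ} < ∞` (i.e. `u ∈ M^δ L²` with
`M = (1+‖x‖²)^{1/2}`), then `|u(x)| ≤ C·‖x‖^{2−n}` for some constant `C` and all
`‖x‖ ≥ 2R`.  This is the decay estimate used in Section 3.4 to prove injectivity of
the Laplacian on the weighted domain `H²_{δ,D}` for `δ < n/2`. -/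
theorem harmonic_decay_exterior_domain (n : ℕ) (hn : 3 ≤ n) (R : ℝ) (hR : 0 < R)
    (δ : ℝ) (hδ : δ < n / 2)
    (u : EuclideanSpace ℝ (Fin n) → ℝ)
    (hu : IsHarmonicOnE u {x : EuclideanSpace ℝ (Fin n) | R < ‖x‖})
    (hint : IntegrableOn (fun x : EuclideanSpace ℝ (Fin n) =>
        u x ^ 2 * (1 + ‖x‖ ^ 2) ^ (-δ))
      {x : EuclideanSpace ℝ (Fin n) | R < ‖x‖} volume) :
    ∃ C : ℝ, ∀ x : EuclideanSpace ℝ (Fin n), 2 * R ≤ ‖x‖ →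
      |u x| ≤ C * ‖x‖ ^ ((2 : ℝ) - n) := by
  have hopen : IsOpen {x : EuclideanSpace ℝ (Fin n) | R < ‖x‖} :=
    isOpen_lt continuous_const continuous_norm
  have hcd (z : EuclideanSpace ℝ (Fin n)) (hz : R < ‖z‖) : ContDiffAt ℝ 2 u z :=
    hu.1.contDiffAt (hopen.mem_nhds hz)
  simpa only [finrank_euclideanSpace_fin] using
    exists_abs_le_mul_norm_rpow_two_sub_finrank (u := u) hR
      (by rw [finrank_euclideanSpace_fin]; omega) (by rwa [finrank_euclideanSpace_fin]) hcd
      (fun z hz => (hcd z hz).laplacianE_eq_laplacian ▸ hu.2 z hz) hint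
end
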